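/- arXiv:2411.12840 — 2 statements merged into one kernel-verified Lean document; each statement's English description precedes it below -/
import Mathlib

section
/- Aldous–Hoover Theorem (functional form): let X be a standard Borel space and let p be a row-column exchangeable probability measure on ℕ × ℕ → X. Then there exists a measurable function k : [0,1]⁴ → X such that p is the pushforward of the product measure λ ⊗ λ^{⊗ℕ} ⊗ λ^{⊗ℕ} ⊗ λ^{⊗(ℕ×ℕ)} (where λ is Lebesgue measure on [0,1]) under the map (α, ξ, η, ζ) ↦ ((i,j) ↦ k(α, ξ_i, η_j, ζ_{(i,j)})). Equivalently, if (𝒳_{ij}) is a row-column exchangeable array of X-valued random variables, there are i.i.d. uniform [0,1]-valued random variables α, (ξ_i), (η_j), (ζ_{ij}) and a measurable k with (𝒳_{ij}) equal in distribution to (k(α, ξ_i, η_j, ζ_{ij})). -/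
open MeasureTheory ProbabilityTheory

/-- `ν` is the product of the probability measures `μ i` over the (possibly infinite) index
set `ι`: every finite-dimensional cylinder set has the product measure. (For probability
measures this characterizes the countable product measure uniquely.) -/
def IsProductMeasure {ι : Type*} {α : ι → Type*} [∀ i, MeasurableSpace (α i)]
    (μ : ∀ i, Measure (α i)) (ν : Measure (∀ i, α i)) : Prop :=
  ∀ (s : Finset ι) (t : ∀ i, Set (α i)), (∀ i, MeasurableSet (t i)) →
    ν {x | ∀ i ∈ s, x i ∈ t i} = ∏ i ∈ s, μ i (t i)

/-- A measure on `ℕ × ℕ → X` is row-column exchangeable if for every permutation `σ` of `ℕ`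
fixing all but finitely many elements, it is invariant under permuting the rows by `σ` and
under permuting the columns by `σ`. -/
def RowColumnExchangeable {X : Type*} [MeasurableSpace X]
    (p : Measure (ℕ × ℕ → X)) : Prop :=
  ∀ σ : Equiv.Perm ℕ, {n | σ n ≠ n}.Finite →
    p.map (fun x (ij : ℕ × ℕ) => x (σ ij.1, ij.2)) = p ∧
    p.map (fun x (ij : ℕ × ℕ) => x (ij.1, σ ij.2)) = p

/-- Two injections agree on a finite set up to a finitely supported permutation. -/
theorem exists_perm_finite_support_comp_eq {α J : Type*} (K : Finset J) {u v : J → α}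
    (hu : u.Injective) (hv : v.Injective) :
    ∃ σ : Equiv.Perm α, {n | σ n ≠ n}.Finite ∧ ∀ k ∈ K, σ (u k) = v k := by
  classical
  induction K using Finset.induction_on with
  | empty => exact ⟨1, by simp, by simp⟩
  | insert a s ha ih =>
    obtain ⟨σ, hσ, h⟩ := ih
    refine ⟨Equiv.swap (σ (u a)) (v a) * σ, ?_, ?_⟩
    · refine (hσ.union (Set.toFinite ({σ (u a), v a} : Set α))).subset fun n hn => ?_
      by_contra hc
      simp only [Set.mem_union, Set.mem_ofPred_eq, Set.mem_insert_iff, Set.mem_singleton_iff,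
        not_or, not_not] at hc
      apply hn
      rw [Equiv.Perm.mul_apply, hc.1, Equiv.swap_apply_of_ne_of_ne hc.2.1 hc.2.2]
    · intro k hk
      rw [Equiv.Perm.mul_apply]
      rcases Finset.mem_insert.1 hk with rfl | hk
      · exact Equiv.swap_apply_left _ _
      · have hka : k ≠ a := fun e => ha (e ▸ hk)
        rw [h k hk, Equiv.swap_apply_of_ne_of_ne _ (hv.ne hka)]
        rw [← h k hk]
        exact σ.injective.ne (hu.ne hka)

section Exchangeable

variable {X : Type*} [MeasurableSpace X]

/-- The law of a subarray selected by injections of the rows and of the columns does not depend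
on the injections. -/
def InjectionInvariant {ι : Type} (P : Measure (ι × ι → X)) : Prop :=
  ∀ (J K : Type) (s s' : J → ι) (t t' : K → ι), s.Injective → s'.Injective → t.Injective →
    t'.Injective → P.map (fun x (c : J × K) => x (s c.1, t c.2)) =
      P.map (fun x (c : J × K) => x (s' c.1, t' c.2))

theorem RowColumnExchangeable.injectionInvariant {p : Measure (ℕ × ℕ → X)}
    [IsProbabilityMeasure p] (hp : RowColumnExchangeable p) : InjectionInvariant p := by
  classical
  intro J K s s' t t' hs hs' ht ht'
  have hm (s : J → ℕ) (t : K → ℕ) :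
      Measurable fun (x : ℕ × ℕ → X) (c : J × K) => x (s c.1, t c.2) :=
    measurable_pi_lambda _ fun _ => measurable_pi_apply _
  refine (map_eq_iff_forall_finset_map_restrict_eq (hm s t).aemeasurable
    (hm s' t').aemeasurable).2 fun I => ?_
  obtain ⟨σ, hσf, hσ⟩ := exists_perm_finite_support_comp_eq (I.image Prod.fst) hs hs'
  obtain ⟨τ, hτf, hτ⟩ := exists_perm_finite_support_comp_eq (I.image Prod.snd) ht ht'
  have hinv : p.map (fun x (c : ℕ × ℕ) => x (σ c.1, τ c.2)) = p := by
    conv_rhs => rw [← (hp σ hσf).1]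
    conv_rhs => enter [2]; rw [← (hp τ hτf).2]
    rw [Measure.map_map (by fun_prop) (by fun_prop)]
    rfl
  conv_lhs => rw [← hinv]
  rw [Measure.map_map (by fun_prop) (by fun_prop)]
  congr 1
  ext x c
  have h1 := hσ c.1.1 (Finset.mem_image_of_mem _ c.2)
  have h2 := hτ c.1.2 (Finset.mem_image_of_mem _ c.2)
  simp [h1, h2]

theorem InjectionInvariant.map {ι κ : Type} {P : Measure (ι × ι → X)} (hP : InjectionInvariant P)
    {f : κ → ι} (hf : f.Injective) :
    InjectionInvariant (P.map fun x (c : κ × κ) => x (f c.1, f c.2)) := by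
  intro J K s s' t t' hs hs' ht ht'
  rw [Measure.map_map (by fun_prop) (by fun_prop), Measure.map_map (by fun_prop) (by fun_prop)]
  exact hP J K _ _ _ _ (hf.comp hs) (hf.comp hs') (hf.comp ht) (hf.comp ht')

theorem InjectionInvariant.transpose {ι : Type} {P : Measure (ι × ι → X)}
    (hP : InjectionInvariant P) :
    InjectionInvariant (P.map fun x (c : ι × ι) => x c.swap) := by
  intro J K s s' t t' hs hs' ht ht'
  have := congrArg (Measure.map fun x (c : J × K) => x c.swap)
    (hP K J t t' s s' ht ht' hs hs')
  rw [Measure.map_map (by fun_prop) (by fun_prop),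
    Measure.map_map (by fun_prop) (by fun_prop)] at this ⊢
  exact this

end Exchangeable

theorem ENNReal.sq_add_sq_eq {a b : ENNReal} (ha : a ≠ ⊤) (hb : b ≠ ⊤) :
    a * a + b * b = 2 * (a * b) + ((a - b) ^ 2 + (b - a) ^ 2) := by
  wlog hab : a ≤ b generalizing a b
  · rw [add_comm, this hb ha (le_of_not_ge hab), mul_comm b a, add_comm ((b - a) ^ 2)]
  obtain ⟨c, rfl⟩ := exists_add_of_le hab
  rw [ENNReal.add_sub_cancel_left ha, tsub_eq_zero_of_le hab]
  ring

/-- If `φ` is a function of `ψ`, and the pairs `(1_D, φ)` and `(1_D, ψ)` have the same law, then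
the conditional probability of `D` given `ψ` is that of `D` given `φ`. -/
theorem measure_inter_preimage_eq_of_map_restrict_eq {Ω S : Type*} [MeasurableSpace Ω]
    [MeasurableSpace S] {P : Measure Ω} [IsProbabilityMeasure P] {D : Set Ω}
    {φ ψ : Ω → S} {θ : S → S} (hφ : Measurable φ)
    (hψ : Measurable ψ) (hθ : Measurable θ) (hφψ : ∀ ω, φ ω = θ (ψ ω))
    (hlaw : P.map φ = P.map ψ) (hlawD : (P.restrict D).map φ = (P.restrict D).map ψ)
    {q : S → ENNReal} (hq : Measurable q) (hq1 : ∀ s, q s ≤ 1)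
    (hqD : (P.restrict D).map φ = (P.map φ).withDensity q) {A : Set S} (hA : MeasurableSet A) :
    P (ψ ⁻¹' A ∩ D) = ∫⁻ ω in ψ ⁻¹' A, q (φ ω) ∂P := by
  have hqφ : Measurable fun ω => q (φ ω) := by fun_prop
  have hqψ : Measurable fun ω => q (ψ ω) := by fun_prop
  have hqθ : Measurable fun s => q (θ s) := by fun_prop
  have hφD (g : S → ENNReal) (hg : Measurable g) :
      ∫⁻ ω in D, g (φ ω) ∂P = ∫⁻ ω, q (φ ω) * g (φ ω) ∂P := by
    rw [← lintegral_map hg hφ, hqD, lintegral_withDensity_eq_lintegral_mul _ hq hg,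
      lintegral_map (by fun_prop) hφ]
    rfl
  have hψD (g : S → ENNReal) (hg : Measurable g) :
      ∫⁻ ω in D, g (ψ ω) ∂P = ∫⁻ ω, q (ψ ω) * g (ψ ω) ∂P := by
    rw [← lintegral_map hg hψ, ← hlawD, hqD, hlaw,
      lintegral_withDensity_eq_lintegral_mul _ hq hg, lintegral_map (by fun_prop) hψ]
    rfl
  have h1 : ∫⁻ ω, q (ψ ω) * q (φ ω) ∂P = ∫⁻ ω, q (φ ω) * q (φ ω) ∂P := by
    rw [← hφD q hq]
    simp_rw [hφψ]
    exact (hψD _ hqθ).symm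
  have h2 : ∫⁻ ω, q (ψ ω) * q (ψ ω) ∂P = ∫⁻ ω, q (φ ω) * q (φ ω) ∂P := by
    rw [← hψD q hq, ← hφD q hq, ← lintegral_map hq hφ, ← lintegral_map hq hψ, hlawD]
  have hfin : ∫⁻ ω, q (φ ω) * q (φ ω) ∂P ≠ ⊤ := by
    refine ne_top_of_le_ne_top ENNReal.one_ne_top ?_
    calc ∫⁻ ω, q (φ ω) * q (φ ω) ∂P ≤ ∫⁻ _, 1 ∂P :=
          lintegral_mono fun ω => mul_le_one' (hq1 _) (hq1 _)
      _ = 1 := by simp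
  have hne (s : S) : q s ≠ ⊤ := ne_top_of_le_ne_top ENNReal.one_ne_top (hq1 s)
  have hzero : ∫⁻ ω, ((q (ψ ω) - q (φ ω)) ^ 2 + (q (φ ω) - q (ψ ω)) ^ 2) ∂P = 0 := by
    have := lintegral_congr (μ := P) fun ω => ENNReal.sq_add_sq_eq (hne (ψ ω)) (hne (φ ω))
    rw [lintegral_add_left (by fun_prop), lintegral_add_left (by fun_prop),
      lintegral_const_mul _ (by fun_prop), h1, h2, ← two_mul] at this
    exact (ENNReal.add_right_inj (ENNReal.mul_ne_top ENNReal.ofNat_ne_top hfin)).1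
      (by rw [add_zero]; exact this.symm)
  have hae : ∀ᵐ ω ∂P, q (ψ ω) = q (φ ω) := by
    filter_upwards [(lintegral_eq_zero_iff (by fun_prop)).1 hzero] with ω hω
    simp only [Pi.zero_apply, add_eq_zero, ne_eq, OfNat.ofNat_ne_zero, not_false_eq_true,
      pow_eq_zero_iff, tsub_eq_zero_iff_le] at hω
    exact le_antisymm hω.1 hω.2
  calc P (ψ ⁻¹' A ∩ D) = ((P.restrict D).map ψ) A := by
        rw [Measure.map_apply hψ hA, Measure.restrict_apply (hψ hA)]
    _ = ∫⁻ ω in ψ ⁻¹' A, q (ψ ω) ∂P := by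
        rw [← hlawD, hqD, hlaw, withDensity_apply _ hA, setLIntegral_map hA hq hψ]
    _ = _ := lintegral_congr_ae (ae_restrict_of_ae hae)

section ConditionalProduct

variable {Ω Z ι E : Type*} [MeasurableSpace Ω] [MeasurableSpace Z] [MeasurableSpace E]

theorem ext_prod_pi_of_finset {μ ν : Measure (Z × (ι → E))} [IsFiniteMeasure μ]
    [IsFiniteMeasure ν]
    (h : ∀ (D : Set Z) (s : Finset ι) (t : ι → Set E), MeasurableSet D →
      (∀ i, MeasurableSet (t i)) → μ (D ×ˢ (s : Set ι).pi t) = ν (D ×ˢ (s : Set ι).pi t)) :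
    μ = ν := by
  refine Measure.ext_prod fun {D T} hD hT => ?_
  have key (ρ : Measure (Z × (ι → E))) {T : Set (ι → E)} (hT : MeasurableSet T) :
      ((ρ.restrict (D ×ˢ Set.univ)).map Prod.snd) T = ρ (D ×ˢ T) := by
    rw [Measure.map_apply measurable_snd hT, Measure.restrict_apply (measurable_snd hT)]
    congr 1
    ext z
    simp [and_comm]
  rw [← key μ hT, ← key ν hT]
  congr 1
  refine ext_of_generate_finite _ generateFrom_squareCylinders.symm
    (isPiSystem_squareCylinders (fun _ => MeasurableSpace.isPiSystem_measurableSet)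
      fun _ => MeasurableSet.univ) ?_ ?_
  · rintro _ ⟨s, t, ht, rfl⟩
    have ht' : ∀ i, MeasurableSet (t i) := fun i => ht i trivial
    have hm : MeasurableSet ((s : Set ι).pi t) :=
      MeasurableSet.pi s.countable_toSet fun i _ => ht' i
    rw [key μ hm, key ν hm, h D s t hD ht']
  · rw [key μ .univ, key ν .univ]
    simpa using h D ∅ (fun _ => Set.univ) hD fun _ => .univ

/-- If the `Y a` are conditionally independent given `V`, with conditional laws `κ a`, then `Y` can
be coded by `V` and independent uniform variables. -/
theorem map_prodMk_eq_map_prod_infinitePi {P : Measure Ω} [IsProbabilityMeasure P] {V : Ω → Z}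
    {Y : ι → Ω → E} (hV : Measurable V) (hY : ∀ i, Measurable (Y i)) (κ : ι → Kernel Z E)
    (h : ∀ (a : ι) (s : Finset ι) (t : ι → Set E) (D : Set Z), a ∉ s → MeasurableSet D →
      (∀ i, MeasurableSet (t i)) →
      P ({ω | V ω ∈ D ∧ ∀ i ∈ s, Y i ω ∈ t i} ∩ {ω | Y a ω ∈ t a}) =
        ∫⁻ ω in {ω | V ω ∈ D ∧ ∀ i ∈ s, Y i ω ∈ t i}, κ a (V ω) (t a) ∂P)
    {f : ι → Z → unitInterval → E} (hf : ∀ i, Measurable (Function.uncurry (f i)))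
    (hfκ : ∀ i z, volume.map (f i z) = κ i z) :
    P.map (fun ω => (V ω, fun i => Y i ω)) =
      ((P.map V).prod (Measure.infinitePi fun _ : ι => (volume : Measure unitInterval))).map
        fun w => (w.1, fun i => f i w.1 (w.2 i)) := by
  classical
  have : IsProbabilityMeasure (P.map V) := Measure.isProbabilityMeasure_map hV.aemeasurable
  have hF : Measurable fun w : Z × (ι → unitInterval) => (w.1, fun i => f i w.1 (w.2 i)) := by
    refine measurable_fst.prodMk (measurable_pi_lambda _ fun i => ?_)
    exact (hf i).comp (measurable_fst.prodMk ((measurable_pi_apply i).comp measurable_snd))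
  have hG : Measurable fun ω => (V ω, fun i => Y i ω) :=
    hV.prodMk (measurable_pi_lambda _ hY)
  have hdens (s : Finset ι) (t : ι → Set E) (ht : ∀ i, MeasurableSet (t i)) :
      (P.restrict {ω | ∀ i ∈ s, Y i ω ∈ t i}).map V =
        (P.map V).withDensity fun z => ∏ i ∈ s, κ i z (t i) := by
    induction s using Finset.induction_on with
    | empty => simp [← Pi.one_def]
    | insert a s ha ih =>
      have hκa : Measurable fun z => κ a z (t a) := (κ a).measurable_coe (ht a)
      have hprod : (fun z => ∏ i ∈ insert a s, κ i z (t i)) =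
          (fun z => ∏ i ∈ s, κ i z (t i)) * fun z => κ a z (t a) := by
        ext z
        rw [Finset.prod_insert ha, mul_comm]
        rfl
      rw [hprod, withDensity_mul _ (Finset.measurable_fun_prod _ fun i _ =>
        (κ i).measurable_coe (ht i)) hκa, ← ih]
      ext D hD
      rw [Measure.map_apply hV hD, Measure.restrict_apply (hV hD), withDensity_apply _ hD,
        setLIntegral_map hD hκa hV, Measure.restrict_restrict (hV hD)]
      refine Eq.trans (congrArg P ?_) (h a s t D ha hD ht)
      ext ω
      simp only [Finset.forall_mem_insert, Set.mem_inter_iff, Set.mem_preimage, Set.mem_ofPred_eq]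
      tauto
  have hfin : IsFiniteMeasure (((P.map V).prod (Measure.infinitePi fun _ : ι =>
      (volume : Measure unitInterval))).map fun w => (w.1, fun i => f i w.1 (w.2 i))) :=
    have := Measure.isProbabilityMeasure_map (μ := (P.map V).prod
      (Measure.infinitePi fun _ : ι => (volume : Measure unitInterval))) hF.aemeasurable
    inferInstance
  refine ext_prod_pi_of_finset fun D s t hD ht => ?_
  have hbox : MeasurableSet (D ×ˢ (s : Set ι).pi t) :=
    hD.prod (MeasurableSet.pi s.countable_toSet fun i _ => ht i)
  rw [Measure.map_apply hG hbox, Measure.map_apply hF hbox, Measure.prod_apply (hF hbox)]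
  have hleft : (fun ω => (V ω, fun i => Y i ω)) ⁻¹' D ×ˢ (s : Set ι).pi t =
      V ⁻¹' D ∩ {ω | ∀ i ∈ s, Y i ω ∈ t i} := by
    ext ω; simp
  rw [hleft, ← Measure.restrict_apply (hV hD), ← Measure.map_apply hV hD, hdens s t ht,
    withDensity_apply _ hD, ← lintegral_indicator hD]
  refine lintegral_congr fun z => ?_
  by_cases hz : z ∈ D
  · have hright : Prod.mk z ⁻¹' ((fun w : Z × (ι → unitInterval) =>
        (w.1, fun i => f i w.1 (w.2 i))) ⁻¹' D ×ˢ (s : Set ι).pi t) =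
        (s : Set ι).pi fun i => f i z ⁻¹' t i := by
      ext u; simp [hz, Set.mem_pi]
    rw [Set.indicator_of_mem hz, hright, Measure.infinitePi_pi _ fun i _ =>
      (hf i).of_uncurry_left (ht i)]
    refine Finset.prod_congr rfl fun i _ => ?_
    rw [← hfκ, Measure.map_apply (hf i).of_uncurry_left (ht i)]
  · have hright : Prod.mk z ⁻¹' ((fun w : Z × (ι → unitInterval) =>
        (w.1, fun i => f i w.1 (w.2 i))) ⁻¹' D ×ˢ (s : Set ι).pi t) = ∅ := by
      ext u; simp [hz]
    rw [Set.indicator_of_notMem hz, hright, measure_empty]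

end ConditionalProduct

/-- If `φ` is a function of `ψ`, and the pairs `(φ, ξ)`, `(φ₀, ξ₀)` and `(ψ, ξ')` have the same law,
then the conditional law of `ξ` given an event determined by `ψ` is that of `ξ₀` given `φ₀`. -/
theorem measure_inter_preimage_eq_setLIntegral_condDistrib {Ω S E : Type*} [MeasurableSpace Ω]
    [MeasurableSpace S] [MeasurableSpace E] [StandardBorelSpace E] [Nonempty E] {P : Measure Ω}
    [IsProbabilityMeasure P] {φ₀ φ ψ : Ω → S} {ξ₀ ξ ξ' : Ω → E} {τ : S → Ω}
    (hφ₀ : Measurable φ₀) (hφ : Measurable φ) (hψ : Measurable ψ) (hξ₀ : Measurable ξ₀)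
    (hξ : Measurable ξ) (hξ' : Measurable ξ') (hτ : Measurable τ)
    (h₀ : P.map (fun ω => (φ ω, ξ ω)) = P.map (fun ω => (φ₀ ω, ξ₀ ω)))
    (h : P.map (fun ω => (φ ω, ξ ω)) = P.map (fun ω => (ψ ω, ξ' ω)))
    (hφτ : ∀ ω, φ (τ (ψ ω)) = φ ω) {G : Set Ω} (hG : MeasurableSet G)
    (hGτ : ∀ ω, τ (ψ ω) ∈ G ↔ ω ∈ G) {T : Set E} (hT : MeasurableSet T)
    (hTξ : ∀ ω, ξ' ω ∈ T ↔ ξ ω ∈ T) :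
    P (G ∩ {ω | ξ ω ∈ T}) = ∫⁻ ω in G, condDistrib ξ₀ φ₀ P (φ ω) T ∂P := by
  have hrect {φ : Ω → S} {ξ : Ω → E} (hφ : Measurable φ) (hξ : Measurable ξ) {A : Set S}
      (hA : MeasurableSet A) {T : Set E} (hT : MeasurableSet T) :
      P.map (fun ω => (φ ω, ξ ω)) (A ×ˢ T) = (P.restrict {ω | ξ ω ∈ T}).map φ A := by
    rw [Measure.map_apply (hφ.prodMk hξ) (hA.prod hT), Measure.map_apply hφ hA,
      Measure.restrict_apply (hφ hA)]
    rfl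
  have hfst {φ : Ω → S} {ξ : Ω → E} (hφ : Measurable φ) (hξ : Measurable ξ) :
      (P.map fun ω => (φ ω, ξ ω)).map Prod.fst = P.map φ := by
    rw [Measure.map_map measurable_fst (hφ.prodMk hξ)]
    rfl
  have hGψ : ψ ⁻¹' (τ ⁻¹' G) = G := Set.ext hGτ
  have hTeq : {ω | ξ' ω ∈ T} = {ω | ξ ω ∈ T} := Set.ext hTξ
  have hmain := measure_inter_preimage_eq_of_map_restrict_eq (P := P) (D := {ω | ξ ω ∈ T})
    (θ := fun s => φ (τ s)) (q := fun s => condDistrib ξ₀ φ₀ P s T) hφ hψ (hφ.comp hτ)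
    (fun ω => (hφτ ω).symm) (by rw [← hfst hφ hξ, h, hfst hψ hξ'])
    (by
      ext A hA
      rw [← hrect hφ hξ hA hT, h, hrect hψ hξ' hA hT, hTeq])
    ((condDistrib ξ₀ φ₀ P).measurable_coe hT) (fun _ => prob_le_one)
    (by
      ext A hA
      rw [← hrect hφ hξ hA hT, h₀, ← compProd_map_condDistrib hξ₀.aemeasurable,
        Measure.compProd_apply_prod hA hT, withDensity_apply _ hA, ← hfst hφ hξ, h₀,
        hfst hφ₀ hξ₀])
    (hτ hG)
  rwa [hGψ] at hmain

theorem exists_equiv_sum_eq_inr (F : Finset ℕ) : ∃ β : ℕ ≃ ℕ ⊕ ℕ, ∀ n ∈ F, β n = Sum.inr n := by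
  obtain ⟨σ, -, hσ⟩ := exists_perm_finite_support_comp_eq F
    Equiv.natSumNatEquivNat.symm.injective (Sum.inr_injective (α := ℕ))
  exact ⟨Equiv.natSumNatEquivNat.symm.trans σ, hσ⟩

theorem exists_equiv_option_eq (r : ℕ ⊕ ℕ) : ∃ β : Option ℕ ≃ ℕ ⊕ ℕ, β none = r := by
  obtain ⟨β⟩ := nonempty_equiv_of_countable (α := Option ℕ) (β := ℕ ⊕ ℕ)
  exact ⟨β.trans (Equiv.swap (β none) r), by simp⟩

section Blocks

variable {X : Type*} [MeasurableSpace X]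

/-- The part of an array in the reference rows and the reference columns. -/
def refBlock (x : (ℕ ⊕ ℕ) × (ℕ ⊕ ℕ) → X) (c : ℕ × ℕ) : X := x (Sum.inr c.1, Sum.inr c.2)

/-- The part of row `i` in the reference columns. -/
def rowBlock (x : (ℕ ⊕ ℕ) × (ℕ ⊕ ℕ) → X) (i n : ℕ) : X := x (Sum.inl i, Sum.inr n)

/-- The part of column `j` in the reference rows. -/
def colBlock (x : (ℕ ⊕ ℕ) × (ℕ ⊕ ℕ) → X) (j n : ℕ) : X := x (Sum.inr n, Sum.inl j)

@[fun_prop]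
theorem measurable_refBlock :
    Measurable (refBlock : ((ℕ ⊕ ℕ) × (ℕ ⊕ ℕ) → X) → ℕ × ℕ → X) :=
  measurable_pi_lambda _ fun _ => measurable_pi_apply _

@[fun_prop]
theorem measurable_rowBlock :
    Measurable (rowBlock : ((ℕ ⊕ ℕ) × (ℕ ⊕ ℕ) → X) → ℕ → ℕ → X) :=
  measurable_pi_lambda _ fun _ => measurable_pi_lambda _ fun _ => measurable_pi_apply _

@[fun_prop]
theorem measurable_colBlock :
    Measurable (colBlock : ((ℕ ⊕ ℕ) × (ℕ ⊕ ℕ) → X) → ℕ → ℕ → X) :=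
  measurable_pi_lambda _ fun _ => measurable_pi_lambda _ fun _ => measurable_pi_apply _

theorem InjectionInvariant.map_comp_eq {ι J K : Type} {P : Measure (ι × ι → X)}
    (hP : InjectionInvariant P) {s s' : J → ι} {t t' : K → ι} (hs : s.Injective)
    (hs' : s'.Injective) (ht : t.Injective) (ht' : t'.Injective) {S : Type*} [MeasurableSpace S]
    {f : (J × K → X) → S} (hf : Measurable f) :
    P.map (fun x => f fun c => x (s c.1, t c.2)) =
      P.map (fun x => f fun c => x (s' c.1, t' c.2)) := by
  have hm (s : J → ι) (t : K → ι) :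
      Measurable fun (x : ι × ι → X) (c : J × K) => x (s c.1, t c.2) :=
    measurable_pi_lambda _ fun _ => measurable_pi_apply _
  have := congrArg (Measure.map f) (hP J K s s' t t' hs hs' ht ht')
  rwa [Measure.map_map hf (hm _ _), Measure.map_map hf (hm _ _)] at this

variable [StandardBorelSpace X] [Nonempty X] {P : Measure ((ℕ ⊕ ℕ) × (ℕ ⊕ ℕ) → X)}
  [IsProbabilityMeasure P]

/-- The row blocks are conditionally independent given the reference block, also of all other
rows, with a common conditional law. -/
theorem InjectionInvariant.exists_rowBlock_kernel (hP : InjectionInvariant P) :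
    ∃ κ : Kernel (ℕ × ℕ → X) (ℕ → X), IsMarkovKernel κ ∧
      ∀ (i : ℕ) (G : Set ((ℕ ⊕ ℕ) × (ℕ ⊕ ℕ) → X)), MeasurableSet G →
        (∀ x y, (∀ r c, r ≠ Sum.inl i → x (r, c) = y (r, c)) → (x ∈ G ↔ y ∈ G)) →
        ∀ T : Set (ℕ → X), MeasurableSet T →
          P (G ∩ {x | rowBlock x i ∈ T}) = ∫⁻ x in G, κ (refBlock x) T ∂P := by
  refine ⟨condDistrib (fun x => rowBlock x 0) refBlock P, inferInstance,
    fun i G hG hGi T hT => ?_⟩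
  have hrow : Measurable fun x : (ℕ ⊕ ℕ) × (ℕ ⊕ ℕ) → X => rowBlock x i := by fun_prop
  set κ := condDistrib (fun x => rowBlock x 0) refBlock P
  let μ₁ := (P.restrict G).map fun x => rowBlock x i
  let μ₂ := ((P.restrict G).map refBlock).bind κ
  have h₁ {T : Set (ℕ → X)} (hT : MeasurableSet T) : μ₁ T = P (G ∩ {x | rowBlock x i ∈ T}) := by
    rw [Measure.map_apply hrow hT, Measure.restrict_apply (hrow hT), Set.inter_comm]
    rfl
  have h₂ {T : Set (ℕ → X)} (hT : MeasurableSet T) :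
      μ₂ T = ∫⁻ x in G, κ (refBlock x) T ∂P := by
    rw [Measure.bind_apply hT κ.aemeasurable, lintegral_map (κ.measurable_coe hT)
      measurable_refBlock]
  rw [← h₁ hT, ← h₂ hT]
  congr 1
  refine ext_of_generate_finite _ generateFrom_measurableCylinders.symm
    isPiSystem_measurableCylinders ?_ ?_
  · rintro T' hT'
    have hC := MeasurableSet.of_mem_measurableCylinders hT'
    obtain ⟨F, B, -, rfl⟩ := (mem_measurableCylinders _).1 hT'
    rw [h₁ hC, h₂ hC]
    obtain ⟨β, hβ⟩ := exists_equiv_sum_eq_inr F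
    obtain ⟨ρ, hρ⟩ := exists_equiv_option_eq (Sum.inl i)
    have hρinv {r : ℕ ⊕ ℕ} (hr : r ≠ Sum.inl i) : ρ (some ((ρ.symm r).getD 0)) = r := by
      cases hc : ρ.symm r with
      | none => exact absurd (by rw [← hρ, ← hc, Equiv.apply_symm_apply]) hr
      | some m => rw [Option.getD_some, ← hc, Equiv.apply_symm_apply]
    let s (i : ℕ) (a : Option ℕ) : ℕ ⊕ ℕ := a.elim (Sum.inl i) Sum.inr
    have hs (i : ℕ) : (s i).Injective := by
      rintro (_ | a) (_ | b) hab <;> simp_all [s]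
    let g (y : Option ℕ × ℕ → X) : (ℕ × ℕ → X) × (ℕ → X) :=
      (fun c => y (some c.1, c.2), fun n => y (none, n))
    have hg : Measurable g := by fun_prop
    refine measure_inter_preimage_eq_setLIntegral_condDistrib
      (φ₀ := refBlock) (φ := refBlock) (ψ := fun x c => x (ρ (some c.1), β c.2))
      (ξ₀ := fun x => rowBlock x 0) (ξ := fun x => rowBlock x i) (ξ' := fun x n => x (ρ none, β n))
      (τ := fun a c => a ((ρ.symm c.1).getD 0, β.symm c.2)) (by fun_prop) (by fun_prop)
      (by fun_prop) (by fun_prop) (by fun_prop) (by fun_prop) (by fun_prop)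
      (hP.map_comp_eq (hs i) (hs 0) Sum.inr_injective Sum.inr_injective hg)
      (hP.map_comp_eq (hs i) ρ.injective Sum.inr_injective β.injective hg) ?_ hG ?_ hC ?_
    · intro x
      ext c
      simp [refBlock, hρinv]
    · intro x
      refine hGi _ _ fun r c hr => ?_
      simp [hρinv hr]
    · intro x
      have : F.restrict (fun n => x (ρ none, β n)) = F.restrict (rowBlock x i) := by
        ext n
        simp [rowBlock, hρ, hβ n n.2]
      rw [mem_cylinder, mem_cylinder, this]
  · rw [h₁ .univ, h₂ .univ]
    simp

/-- The column blocks are conditionally independent given the reference block, also of all other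
columns, with a common conditional law. -/
theorem InjectionInvariant.exists_colBlock_kernel (hP : InjectionInvariant P) :
    ∃ κ : Kernel (ℕ × ℕ → X) (ℕ → X), IsMarkovKernel κ ∧
      ∀ (j : ℕ) (G : Set ((ℕ ⊕ ℕ) × (ℕ ⊕ ℕ) → X)), MeasurableSet G →
        (∀ x y, (∀ r c, c ≠ Sum.inl j → x (r, c) = y (r, c)) → (x ∈ G ↔ y ∈ G)) →
        ∀ T : Set (ℕ → X), MeasurableSet T →
          P (G ∩ {x | colBlock x j ∈ T}) = ∫⁻ x in G, κ (refBlock x) T ∂P := by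
  let tr (x : (ℕ ⊕ ℕ) × (ℕ ⊕ ℕ) → X) (c : (ℕ ⊕ ℕ) × (ℕ ⊕ ℕ)) : X := x c.swap
  have htr : Measurable tr := measurable_pi_lambda _ fun _ => measurable_pi_apply _
  have := Measure.isProbabilityMeasure_map (μ := P) htr.aemeasurable
  obtain ⟨κ, hκ, h⟩ := InjectionInvariant.exists_rowBlock_kernel (P := P.map tr) hP.transpose
  have hsw : Measurable fun (a : ℕ × ℕ → X) (c : ℕ × ℕ) => a c.swap :=
    measurable_pi_lambda _ fun _ => measurable_pi_apply _
  refine ⟨κ.comap _ hsw, inferInstance, fun j G hG hGj T hT => ?_⟩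
  have key := h j (tr ⁻¹' G) (htr hG) (fun x y hxy => hGj _ _ fun r c hc => hxy c r hc) T hT
  have hrow : MeasurableSet {x : (ℕ ⊕ ℕ) × (ℕ ⊕ ℕ) → X | rowBlock x j ∈ T} :=
    (show Measurable fun x : (ℕ ⊕ ℕ) × (ℕ ⊕ ℕ) → X => rowBlock x j by fun_prop) hT
  rw [Measure.map_apply htr ((htr hG).inter hrow), setLIntegral_map
    (f := fun x => κ (refBlock x) T) (htr hG) ((κ.measurable_coe hT).comp measurable_refBlock)
    htr] at key
  exact key

/-- Each cell is conditionally independent of all the others given the reference block and the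
blocks of its row and its column, with a common conditional law. -/
theorem InjectionInvariant.exists_cell_kernel (hP : InjectionInvariant P) :
    ∃ κ : Kernel ((ℕ × ℕ → X) × (ℕ → X) × (ℕ → X)) X, IsMarkovKernel κ ∧
      ∀ (i j : ℕ) (G : Set ((ℕ ⊕ ℕ) × (ℕ ⊕ ℕ) → X)), MeasurableSet G →
        (∀ x y, (∀ c, c ≠ (Sum.inl i, Sum.inl j) → x c = y c) → (x ∈ G ↔ y ∈ G)) →
        ∀ T : Set X, MeasurableSet T →
          P (G ∩ {x | x (Sum.inl i, Sum.inl j) ∈ T}) =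
            ∫⁻ x in G, κ (refBlock x, rowBlock x i, colBlock x j) T ∂P := by
  refine ⟨condDistrib (fun x => x (Sum.inl 0, Sum.inl 0))
    (fun x => (refBlock x, rowBlock x 0, colBlock x 0)) P, inferInstance,
    fun i j G hG hGij T hT => ?_⟩
  obtain ⟨ρ, hρ⟩ := exists_equiv_option_eq (Sum.inl i)
  obtain ⟨β, hβ⟩ := exists_equiv_option_eq (Sum.inl j)
  let s (i : ℕ) (a : Option ℕ) : ℕ ⊕ ℕ := a.elim (Sum.inl i) Sum.inr
  have hs (i : ℕ) : (s i).Injective := by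
    rintro (_ | a) (_ | b) hab <;> simp_all [s]
  let g (y : Option ℕ × Option ℕ → X) : (ℕ × ℕ → X) × (ℕ → X) × (ℕ → X) :=
    (fun c => y (some c.1, some c.2), fun n => y (none, some n), fun n => y (some n, none))
  have hg : Measurable g := by fun_prop
  have hgξ : Measurable fun y => (g y, y (none, none)) := by fun_prop
  obtain ⟨x₀⟩ := ‹Nonempty X›
  let dec (a : (ℕ × ℕ → X) × (ℕ → X) × (ℕ → X)) : Option ℕ × Option ℕ → X
    | (some m, some n) => a.1 (m, n)
    | (none, some n) => a.2.1 n
    | (some m, none) => a.2.2 m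
    | (none, none) => x₀
  have hdec : Measurable dec := by
    refine measurable_pi_lambda _ ?_
    rintro ⟨_ | m, _ | n⟩ <;> simp only [dec] <;> fun_prop
  let τ (a : (ℕ × ℕ → X) × (ℕ → X) × (ℕ → X)) (c : (ℕ ⊕ ℕ) × (ℕ ⊕ ℕ)) : X :=
    dec a (ρ.symm c.1, β.symm c.2)
  have hτ : Measurable τ := by fun_prop
  let ψ (x : (ℕ ⊕ ℕ) × (ℕ ⊕ ℕ) → X) := g fun c => x (ρ c.1, β c.2)
  have hτψ (x : (ℕ ⊕ ℕ) × (ℕ ⊕ ℕ) → X) (c : (ℕ ⊕ ℕ) × (ℕ ⊕ ℕ))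
      (hc : c ≠ (Sum.inl i, Sum.inl j)) : τ (ψ x) c = x c := by
    obtain ⟨r, c⟩ := c
    obtain ⟨a, rfl⟩ := ρ.surjective r
    obtain ⟨b, rfl⟩ := β.surjective c
    rcases a with _ | a <;> rcases b with _ | b
    · exact absurd (Prod.ext hρ hβ) hc
    all_goals simp only [τ, ψ, g, dec, Equiv.symm_apply_apply]
  refine measure_inter_preimage_eq_setLIntegral_condDistrib (ψ := ψ)
    (ξ' := fun x => x (ρ none, β none)) (τ := τ)
    (by fun_prop) (by fun_prop) (by fun_prop) (by fun_prop) (by fun_prop) (by fun_prop) hτ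
    (hP.map_comp_eq (hs i) (hs 0) (hs j) (hs 0) hgξ)
    (hP.map_comp_eq (hs i) ρ.injective (hs j) β.injective hgξ) ?_ hG ?_ hT ?_
  · intro x
    refine Prod.ext (funext fun c => ?_) (Prod.ext (funext fun n => ?_) (funext fun n => ?_))
    all_goals exact hτψ x _ (by simp [s])
  · exact fun x => hGij _ _ (hτψ x)
  · simp [hρ, hβ, s]

end Blocks


theorem measurableSet_setOf_mem_and_forall_mem {Ω Z E ι : Type*} [MeasurableSpace Ω]
    [MeasurableSpace Z] [MeasurableSpace E] {V : Ω → Z} {Y : ι → Ω → E} (hV : Measurable V)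
    (hY : ∀ i, Measurable (Y i)) {D : Set Z} (hD : MeasurableSet D) (s : Finset ι)
    {t : ι → Set E} (ht : ∀ i, MeasurableSet (t i)) :
    MeasurableSet {ω | V ω ∈ D ∧ ∀ i ∈ s, Y i ω ∈ t i} := by
  have : {ω | V ω ∈ D ∧ ∀ i ∈ s, Y i ω ∈ t i} = V ⁻¹' D ∩ ⋂ i ∈ s, Y i ⁻¹' t i := by
    ext
    simp
  rw [this]
  exact (hV hD).inter (Finset.measurableSet_biInter s fun i _ => hY i (ht i))

/-- Given the reference block, the row blocks are coded by independent uniforms. -/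
theorem InjectionInvariant.exists_rowBlock_map {X : Type*} [MeasurableSpace X]
    [StandardBorelSpace X] [Nonempty X] {P : Measure ((ℕ ⊕ ℕ) × (ℕ ⊕ ℕ) → X)}
    [IsProbabilityMeasure P] (hP : InjectionInvariant P) :
    ∃ f : (ℕ × ℕ → X) → unitInterval → ℕ → X, Measurable (Function.uncurry f) ∧
      P.map (fun x => (refBlock x, rowBlock x)) =
        ((P.map refBlock).prod
          (Measure.infinitePi fun _ : ℕ => (volume : Measure unitInterval))).map
            fun w => (w.1, fun i => f w.1 (w.2 i)) := by
  obtain ⟨κ, _, hκ⟩ := hP.exists_rowBlock_kernel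
  obtain ⟨f, hf, hfκ⟩ := κ.exists_measurable_map_eq_unitInterval
  have hY (i : ℕ) : Measurable fun x : (ℕ ⊕ ℕ) × (ℕ ⊕ ℕ) → X => rowBlock x i := by fun_prop
  refine ⟨f, hf, map_prodMk_eq_map_prod_infinitePi (Y := fun i x => rowBlock x i)
    measurable_refBlock hY (fun _ => κ) (fun a s t D ha hD ht => ?_) (fun _ => hf)
    (fun _ => hfκ)⟩
  refine hκ a _ (measurableSet_setOf_mem_and_forall_mem measurable_refBlock hY hD s ht)
    (fun x y hxy => ?_) (t a) (ht a)
  have e₁ : refBlock x = refBlock y := funext fun _ => hxy _ _ (by simp)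
  have e₂ : ∀ i ∈ s, rowBlock x i = rowBlock y i := fun i hi => funext fun _ =>
    hxy _ _ fun e => ha (Sum.inl_injective e ▸ hi)
  simp only [Set.mem_ofPred_eq, e₁]
  exact and_congr_right fun _ => forall₂_congr fun i hi => by rw [e₂ i hi]

/-- Given the reference and row blocks, the column blocks are coded by the reference block and
independent uniforms. -/
theorem InjectionInvariant.exists_colBlock_map {X : Type*} [MeasurableSpace X]
    [StandardBorelSpace X] [Nonempty X] {P : Measure ((ℕ ⊕ ℕ) × (ℕ ⊕ ℕ) → X)}
    [IsProbabilityMeasure P] (hP : InjectionInvariant P) :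
    ∃ f : (ℕ × ℕ → X) → unitInterval → ℕ → X, Measurable (Function.uncurry f) ∧
      P.map (fun x => ((refBlock x, rowBlock x), colBlock x)) =
        ((P.map fun x => (refBlock x, rowBlock x)).prod
          (Measure.infinitePi fun _ : ℕ => (volume : Measure unitInterval))).map
            fun w => (w.1, fun j => f w.1.1 (w.2 j)) := by
  obtain ⟨κ, _, hκ⟩ := hP.exists_colBlock_kernel
  obtain ⟨f, hf, hfκ⟩ := κ.exists_measurable_map_eq_unitInterval
  have hV : Measurable fun x : (ℕ ⊕ ℕ) × (ℕ ⊕ ℕ) → X => (refBlock x, rowBlock x) := by fun_prop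
  have hY (j : ℕ) : Measurable fun x : (ℕ ⊕ ℕ) × (ℕ ⊕ ℕ) → X => colBlock x j := by fun_prop
  have hf' : Measurable (Function.uncurry fun z : (ℕ × ℕ → X) × (ℕ → ℕ → X) => f z.1) :=
    hf.comp ((measurable_fst.comp measurable_fst).prodMk measurable_snd)
  refine ⟨f, hf, map_prodMk_eq_map_prod_infinitePi (Y := fun j x => colBlock x j)
    hV hY (fun _ => κ.comap Prod.fst measurable_fst) (fun a s t D ha hD ht => ?_)
    (f := fun _ z => f z.1) (fun _ => hf') (fun _ z => hfκ z.1)⟩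
  refine hκ a _ (measurableSet_setOf_mem_and_forall_mem hV hY hD s ht)
    (fun x y hxy => ?_) (t a) (ht a)
  have e₁ : refBlock x = refBlock y := funext fun _ => hxy _ _ (by simp)
  have e₂ : rowBlock x = rowBlock y := funext₂ fun _ _ => hxy _ _ (by simp)
  have e₃ : ∀ j ∈ s, colBlock x j = colBlock y j := fun j hj => funext fun _ =>
    hxy _ _ fun e => ha (Sum.inl_injective e ▸ hj)
  simp only [Set.mem_ofPred_eq, e₁, e₂]
  exact and_congr_right fun _ => forall₂_congr fun j hj => by rw [e₃ j hj]

/-- Given all blocks, the remaining cells are coded by the reference block, the blocks of their row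
and column, and independent uniforms. -/
theorem InjectionInvariant.exists_cell_map {X : Type*} [MeasurableSpace X]
    [StandardBorelSpace X] [Nonempty X] {P : Measure ((ℕ ⊕ ℕ) × (ℕ ⊕ ℕ) → X)}
    [IsProbabilityMeasure P] (hP : InjectionInvariant P) :
    ∃ f : (ℕ × ℕ → X) × (ℕ → X) × (ℕ → X) → unitInterval → X, Measurable (Function.uncurry f) ∧
      P.map (fun x => (((refBlock x, rowBlock x), colBlock x),
          fun c : ℕ × ℕ => x (Sum.inl c.1, Sum.inl c.2))) =
        ((P.map fun x => ((refBlock x, rowBlock x), colBlock x)).prod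
          (Measure.infinitePi fun _ : ℕ × ℕ => (volume : Measure unitInterval))).map
            fun w => (w.1, fun c => f (w.1.1.1, w.1.1.2 c.1, w.1.2 c.2) (w.2 c)) := by
  obtain ⟨κ, _, hκ⟩ := hP.exists_cell_kernel
  obtain ⟨f, hf, hfκ⟩ := κ.exists_measurable_map_eq_unitInterval
  have hV : Measurable fun x : (ℕ ⊕ ℕ) × (ℕ ⊕ ℕ) → X =>
    ((refBlock x, rowBlock x), colBlock x) := by fun_prop
  have hY (c : ℕ × ℕ) : Measurable fun x : (ℕ ⊕ ℕ) × (ℕ ⊕ ℕ) → X =>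
    x (Sum.inl c.1, Sum.inl c.2) := measurable_pi_apply _
  let g (c : ℕ × ℕ) (z : ((ℕ × ℕ → X) × (ℕ → ℕ → X)) × (ℕ → ℕ → X)) :
      (ℕ × ℕ → X) × (ℕ → X) × (ℕ → X) := (z.1.1, z.1.2 c.1, z.2 c.2)
  have hg (c : ℕ × ℕ) : Measurable (g c) := by fun_prop
  have hf' (c : ℕ × ℕ) : Measurable (Function.uncurry fun z => f (g c z)) :=
    hf.comp (((hg c).comp measurable_fst).prodMk measurable_snd)
  refine ⟨f, hf, map_prodMk_eq_map_prod_infinitePi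
    (Y := fun (c : ℕ × ℕ) x => x (Sum.inl c.1, Sum.inl c.2))
    hV hY (fun c => κ.comap (g c) (hg c)) (fun a s t D ha hD ht => ?_)
    (f := fun c z => f (g c z)) hf' (fun c z => hfκ (g c z))⟩
  refine hκ a.1 a.2 _ (measurableSet_setOf_mem_and_forall_mem hV hY hD s ht)
    (fun x y hxy => ?_) (t a) (ht a)
  have e₁ : refBlock x = refBlock y := funext fun _ => hxy _ (by simp)
  have e₂ : rowBlock x = rowBlock y := funext₂ fun _ _ => hxy _ (by simp)
  have e₃ : colBlock x = colBlock y := funext₂ fun _ _ => hxy _ (by simp)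
  simp only [Set.mem_ofPred_eq, e₁, e₂, e₃]
  refine and_congr_right fun _ => forall₂_congr fun c hc => ?_
  rw [hxy _ fun e => ha ?_]
  obtain ⟨h₁, h₂⟩ := Prod.mk.inj e
  rwa [← Prod.ext (Sum.inl_injective h₁) (Sum.inl_injective h₂)]

theorem map_prod_map_comp {A B C D : Type*} [MeasurableSpace A]
    [MeasurableSpace B] [MeasurableSpace C] [MeasurableSpace D] {μ : Measure A} {ν : Measure B}
    [SFinite μ] [SFinite ν] {φ : A → C} (hφ : Measurable φ) {F : C × B → D} (hF : Measurable F) :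
    ((μ.map φ).prod ν).map F = (μ.prod ν).map (F ∘ Prod.map φ id) := by
  have := Measure.map_prod_map μ ν hφ measurable_id
  rw [Measure.map_id] at this
  rw [this, Measure.map_map hF (hφ.prodMap measurable_id)]

/-- The array outside the reference rows and columns is a function of independent uniforms. -/
theorem InjectionInvariant.exists_map_eq {X : Type*} [MeasurableSpace X]
    [StandardBorelSpace X] [Nonempty X] {P : Measure ((ℕ ⊕ ℕ) × (ℕ ⊕ ℕ) → X)}
    [IsProbabilityMeasure P] (hP : InjectionInvariant P) :
    ∃ k : unitInterval × unitInterval × unitInterval × unitInterval → X, Measurable k ∧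
      P.map (fun x (ij : ℕ × ℕ) => x (Sum.inl ij.1, Sum.inl ij.2)) =
        ((volume : Measure unitInterval).prod
          ((Measure.infinitePi fun _ : ℕ => (volume : Measure unitInterval)).prod
            ((Measure.infinitePi fun _ : ℕ => (volume : Measure unitInterval)).prod
              (Measure.infinitePi fun _ : ℕ × ℕ => (volume : Measure unitInterval))))).map
          (fun w (ij : ℕ × ℕ) => k (w.1, w.2.1 ij.1, w.2.2.1 ij.2, w.2.2.2 ij)) := by
  obtain ⟨f, hf, hfP⟩ := hP.exists_rowBlock_map
  obtain ⟨g, hg, hgP⟩ := hP.exists_colBlock_map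
  obtain ⟨c, hc, hcP⟩ := hP.exists_cell_map
  have := Measure.isProbabilityMeasure_map (μ := P) measurable_refBlock.aemeasurable
  obtain ⟨h, hh, hhP⟩ := (P.map refBlock).exists_measurable_map_eq
  have hF : Measurable fun w : (ℕ × ℕ → X) × (ℕ → unitInterval) =>
      (w.1, fun i => f w.1 (w.2 i)) :=
    measurable_fst.prodMk <| measurable_pi_lambda _ fun i =>
      hf.comp (measurable_fst.prodMk ((measurable_pi_apply i).comp measurable_snd))
  have hG : Measurable fun w : ((ℕ × ℕ → X) × (ℕ → ℕ → X)) × (ℕ → unitInterval) =>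
      (w.1, fun j => g w.1.1 (w.2 j)) :=
    measurable_fst.prodMk <| measurable_pi_lambda _ fun j =>
      hg.comp (f := fun w : ((ℕ × ℕ → X) × (ℕ → ℕ → X)) × (ℕ → unitInterval) =>
        (w.1.1, w.2 j)) (by fun_prop)
  have hC : Measurable fun w : (((ℕ × ℕ → X) × (ℕ → ℕ → X)) × (ℕ → ℕ → X)) ×
      (ℕ × ℕ → unitInterval) => (w.1, fun ij => c (w.1.1.1, w.1.1.2 ij.1, w.1.2 ij.2) (w.2 ij)) :=
    measurable_fst.prodMk <| measurable_pi_lambda _ fun ij =>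
      hc.comp (f := fun w : (((ℕ × ℕ → X) × (ℕ → ℕ → X)) × (ℕ → ℕ → X)) ×
        (ℕ × ℕ → unitInterval) => ((w.1.1.1, w.1.1.2 ij.1, w.1.2 ij.2), w.2 ij)) (by fun_prop)
  have hF' := hF.comp (hh.prodMap (measurable_id (α := ℕ → unitInterval)))
  have hG' := hG.comp (hF'.prodMap (measurable_id (α := ℕ → unitInterval)))
  have hC' := hC.comp (hG'.prodMap (measurable_id (α := ℕ × ℕ → unitInterval)))
  rw [← hhP, map_prod_map_comp hh hF] at hfP
  rw [hfP, map_prod_map_comp hF' hG] at hgP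
  rw [hgP, map_prod_map_comp hG' hC] at hcP
  have hk : Measurable fun w : unitInterval × unitInterval × unitInterval × unitInterval =>
      c (h w.1, f (h w.1) w.2.1, g (h w.1) w.2.2.1) w.2.2.2 := by
    have hf' := hf.comp (f := fun w : unitInterval × unitInterval × unitInterval × unitInterval =>
      (h w.1, w.2.1)) (by fun_prop)
    have hg' := hg.comp (f := fun w : unitInterval × unitInterval × unitInterval × unitInterval =>
      (h w.1, w.2.2.1)) (by fun_prop)
    exact hc.comp (((hh.comp measurable_fst).prodMk (hf'.prodMk hg')).prodMk
      (measurable_snd.comp (measurable_snd.comp measurable_snd)))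
  refine ⟨_, hk, ?_⟩
  have hcell : Measurable fun (x : (ℕ ⊕ ℕ) × (ℕ ⊕ ℕ) → X) (ij : ℕ × ℕ) =>
      x (Sum.inl ij.1, Sum.inl ij.2) := measurable_pi_lambda _ fun _ => measurable_pi_apply _
  have hsnd := congrArg (Measure.map Prod.snd) hcP
  rw [Measure.map_map measurable_snd ((by fun_prop : Measurable fun x =>
    ((refBlock x, rowBlock x), colBlock x)).prodMk hcell),
    Measure.map_map measurable_snd hC'] at hsnd
  refine hsnd.trans ?_
  have hassoc := (measurePreserving_prodAssoc (volume : Measure unitInterval)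
    (Measure.infinitePi fun _ : ℕ => (volume : Measure unitInterval))
    ((Measure.infinitePi fun _ : ℕ => (volume : Measure unitInterval)).prod
      (Measure.infinitePi fun _ : ℕ × ℕ => (volume : Measure unitInterval)))).comp
    (measurePreserving_prodAssoc ((volume : Measure unitInterval).prod
      (Measure.infinitePi fun _ : ℕ => (volume : Measure unitInterval)))
      (Measure.infinitePi fun _ : ℕ => (volume : Measure unitInterval))
      (Measure.infinitePi fun _ : ℕ × ℕ => (volume : Measure unitInterval)))
  rw [← hassoc.map_eq]
  exact (Measure.map_map (measurable_pi_lambda _ fun ij => hk.comp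
    (by fun_prop : Measurable fun w : unitInterval × (ℕ → unitInterval) × (ℕ → unitInterval) ×
      (ℕ × ℕ → unitInterval) => (w.1, w.2.1 ij.1, w.2.2.1 ij.2, w.2.2.2 ij)))
    hassoc.measurable).symm

theorem isProductMeasure_infinitePi {ι : Type*} {α : ι → Type*} [∀ i, MeasurableSpace (α i)]
    (μ : ∀ i, Measure (α i)) [∀ i, IsProbabilityMeasure (μ i)] :
    IsProductMeasure μ (Measure.infinitePi μ) :=
  fun _ _ ht => Measure.infinitePi_pi μ fun i _ => ht i

/-- **Aldous–Hoover Theorem (functional form)**: for every row-column exchangeable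
probability measure `p` on `ℕ × ℕ → X` (`X` standard Borel) there is a measurable function
`k : [0,1]⁴ → X` such that `p` is the pushforward of `λ ⊗ λ^{⊗ℕ} ⊗ λ^{⊗ℕ} ⊗ λ^{⊗(ℕ×ℕ)}`
(`λ` = Lebesgue measure on `[0,1]`, the infinite factors being the product measures `Λ₁`,
`Λ₂`, `Λ₃`) under `(α, ξ, η, ζ) ↦ ((i,j) ↦ k (α, ξ i, η j, ζ (i,j)))`.  Equivalently, a
row-column exchangeable array is equal in distribution to
`(k (α, ξ i, η j, ζ (i,j)))_{i,j}` for i.i.d. uniform `α, (ξ i), (η j), (ζ (i,j))`. -/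
theorem aldousHoover_functional {X : Type*} [MeasurableSpace X] [StandardBorelSpace X]
    (p : Measure (ℕ × ℕ → X)) [IsProbabilityMeasure p] (hp : RowColumnExchangeable p) :
    ∃ k : unitInterval × unitInterval × unitInterval × unitInterval → X, Measurable k ∧
      ∃ (Λ₁ Λ₂ : Measure (ℕ → unitInterval)) (Λ₃ : Measure (ℕ × ℕ → unitInterval)),
        IsProductMeasure (fun _ : ℕ => (volume : Measure unitInterval)) Λ₁ ∧
        IsProductMeasure (fun _ : ℕ => (volume : Measure unitInterval)) Λ₂ ∧
        IsProductMeasure (fun _ : ℕ × ℕ => (volume : Measure unitInterval)) Λ₃ ∧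
        p = ((volume : Measure unitInterval).prod (Λ₁.prod (Λ₂.prod Λ₃))).map
          (fun w (ij : ℕ × ℕ) => k (w.1, w.2.1 ij.1, w.2.2.1 ij.2, w.2.2.2 ij)) := by
  have : Nonempty X := (nonempty_of_isProbabilityMeasure p).map fun x => x (0, 0)
  let e := Equiv.natSumNatEquivNat
  have hm : Measurable fun (x : ℕ × ℕ → X) (c : (ℕ ⊕ ℕ) × (ℕ ⊕ ℕ)) => x (e c.1, e c.2) :=
    measurable_pi_lambda _ fun _ => measurable_pi_apply _
  have := Measure.isProbabilityMeasure_map (μ := p) hm.aemeasurable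
  obtain ⟨k, hk, hkP⟩ := (hp.injectionInvariant.map e.injective).exists_map_eq
  refine ⟨k, hk, _, _, _, isProductMeasure_infinitePi _, isProductMeasure_infinitePi _,
    isProductMeasure_infinitePi _, Eq.trans ?_ hkP⟩
  have hinl : Function.Injective fun i => e (Sum.inl i) := e.injective.comp Sum.inl_injective
  rw [Measure.map_map (measurable_pi_lambda _ fun _ => measurable_pi_apply _) hm]
  exact Measure.map_id.symm.trans <| hp.injectionInvariant ℕ ℕ id _ id _
    Function.injective_id hinl Function.injective_id hinl
end

section
/- De Finetti Theorem for dilations (strong form): let X and Y be standard Borel spaces and let π be a probability measure on (ℕ → X) × Y that is invariant under (x, y) ↦ (x ∘ σ, y) for every permutation σ of ℕ fixing all but finitely many elements. Let p be the marginal of π on ℕ → X, let κ : (ℕ → X) → X be a regular conditional distribution of the coordinate x₀ given the shifted sequence (x_{k+1})_{k∈ℕ} under p, and let h : (ℕ → X) → Y be a regular conditional distribution of y given x under π. Then for every n ∈ ℕ, the joint law under π of ((x₀, …, x_{n−1}), (x_{n+k})_{k∈ℕ}, y) equals the measure obtained by sampling t ∈ (ℕ → X) from p, then independently sampling the n components i.i.d.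 from κ(t) and sampling y from h(t), and outputting ((the n samples), t, y). -/
open MeasureTheory ProbabilityTheory
open scoped ProbabilityTheory

theorem Function.Injective.exists_perm_eqOn_finset {f : ℕ → ℕ} (hf : Function.Injective f)
    (s : Finset ℕ) :
    ∃ σ : Equiv.Perm ℕ, {n | σ n ≠ n}.Finite ∧ ∀ n ∈ s, σ n = f n := by
  induction s using Finset.induction_on with
  | empty => exact ⟨1, by simp, by simp⟩
  | insert a s ha ih =>
    obtain ⟨σ, hσ, hs⟩ := ih
    refine ⟨Equiv.swap (f a) (σ a) * σ, ?_, fun n hn => ?_⟩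
    · refine (hσ.union (Set.toFinite {σ.symm (f a), a})).subset fun n hn => ?_
      by_contra hcon
      simp only [Set.mem_union, Set.mem_ofPred_eq, Set.mem_insert_iff, Set.mem_singleton_iff,
        not_or, not_not] at hcon
      obtain ⟨h1, h2, h3⟩ := hcon
      refine hn ?_
      rw [Equiv.Perm.mul_apply, Equiv.swap_apply_of_ne_of_ne, h1]
      · exact fun h => h2 (by rw [← h, Equiv.symm_apply_apply])
      · exact fun h => h3 (σ.injective h)
    · rcases Finset.mem_insert.1 hn with rfl | hn
      · simp
      · have hne : n ≠ a := fun h => ha (h ▸ hn)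
        rw [Equiv.Perm.mul_apply, Equiv.swap_apply_of_ne_of_ne, hs n hn]
        · rw [hs n hn]; exact fun h => hne (hf h)
        · exact fun h => hne (σ.injective h)

/-- Invariance under finite permutations implies invariance under all injective
reindexings. -/
theorem map_comp_injective_eq_of_exchangeable {X Y : Type*} [MeasurableSpace X]
    [MeasurableSpace Y] (π : Measure ((ℕ → X) × Y)) [IsProbabilityMeasure π]
    (hπ : ∀ σ : Equiv.Perm ℕ, {n | σ n ≠ n}.Finite →
      π.map (fun xy => (xy.1 ∘ σ, xy.2)) = π)
    {f : ℕ → ℕ} (hf : Function.Injective f) :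
    π.map (fun xy => (xy.1 ∘ f, xy.2)) = π := by
  have hmeas (g : ℕ → ℕ) : Measurable fun xy : (ℕ → X) × Y => (xy.1 ∘ g, xy.2) := by
    refine Measurable.prodMk (measurable_pi_lambda _ fun n => ?_) measurable_snd
    exact (measurable_pi_apply (g n)).comp measurable_fst
  have hprob := Measure.isProbabilityMeasure_map (μ := π) (hmeas f).aemeasurable
  have hgen : MeasurableSpace.generateFrom
      (Set.image2 (· ×ˢ ·) (measurableCylinders fun _ : ℕ => X) {t : Set Y | MeasurableSet t}) =
      Prod.instMeasurableSpace := by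
    refine generateFrom_eq_prod generateFrom_measurableCylinders
      MeasurableSpace.generateFrom_measurableSet ?_ isCountablySpanning_measurableSet
    exact ⟨fun _ => Set.univ, fun _ => univ_mem_measurableCylinders _, Set.iUnion_const _⟩
  refine ext_of_generate_finite _ hgen.symm
    (isPiSystem_measurableCylinders.prod MeasurableSpace.isPiSystem_measurableSet) ?_ (by simp)
  rintro _ ⟨A, hA, B, hB, rfl⟩
  have hAm := MeasurableSet.of_mem_measurableCylinders hA
  obtain ⟨s, S, hS, rfl⟩ := (mem_measurableCylinders A).1 hA
  obtain ⟨σ, hσ, hs⟩ := hf.exists_perm_eqOn_finset s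
  conv_rhs => rw [← hπ σ hσ]
  rw [Measure.map_apply (hmeas f) (hAm.prod hB), Measure.map_apply (hmeas σ) (hAm.prod hB)]
  congr 1
  ext ⟨x, y⟩
  have : s.restrict (x ∘ f) = s.restrict (x ∘ σ) := by
    ext i
    simp [hs i i.2]
  simp only [Set.mem_preimage, Set.mem_prod, mem_cylinder, this]

/-- A kernel whose joint law with `p` is invariant under a transformation of the conditioning
variable is almost surely invariant under this transformation. -/
theorem ae_apply_eq_of_map_compProd_eq {T Z : Type*} [MeasurableSpace T] [MeasurableSpace Z]
    [MeasurableSpace.CountableOrCountablyGenerated T Z]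
    (p : Measure T) [IsProbabilityMeasure p] (k : Kernel T Z) [IsMarkovKernel k]
    {S : T → T} (hS : Measurable S) (hinv : (p ⊗ₘ k).map (Prod.map S id) = p ⊗ₘ k) :
    ∀ᵐ t ∂p, k (S t) = k t := by
  have hp : p.map S = p := by
    have h1 := congrArg Measure.fst hinv
    rw [Measure.fst_compProd] at h1
    conv_rhs => rw [← h1]
    rw [Measure.fst, Measure.map_map measurable_fst (hS.prodMap measurable_id)]
    conv_lhs => rw [← Measure.fst_compProd p k]
    rw [Measure.fst, Measure.map_map hS measurable_fst]
    rfl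
  have key (B : Set Z) (hB : MeasurableSet B) : ∀ᵐ t ∂p, k (S t) B = k t B := by
    let g : T → ℝ := fun t => (k t).real B
    have hg : Measurable g := (k.measurable_coe hB).ennreal_toReal
    have hg1 (t) : ‖g t‖ ≤ 1 := by
      rw [Real.norm_of_nonneg measureReal_nonneg]; exact measureReal_le_one
    have hint {u v : T → ℝ} (hu : Measurable u) (hv : Measurable v)
        (hu1 : ∀ t, ‖u t‖ ≤ 1) (hv1 : ∀ t, ‖v t‖ ≤ 1) :
        Integrable (fun t => u t * v t) p := by
      refine Integrable.of_bound (hu.mul hv).aestronglyMeasurable 1 (ae_of_all _ fun t => ?_)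
      rw [norm_mul]
      exact mul_le_one₀ (hu1 t) (norm_nonneg _) (hv1 t)
    have hind : Measurable (B.indicator (fun _ => (1 : ℝ))) := measurable_const.indicator hB
    have hpair {u : T → ℝ} (hu : Measurable u) (hu1 : ∀ t, ‖u t‖ ≤ 1) :
        ∫ q, u q.1 * B.indicator (fun _ => (1 : ℝ)) q.2 ∂(p ⊗ₘ k) = ∫ t, u t * g t ∂p := by
      rw [Measure.integral_compProd]
      · refine integral_congr_ae (ae_of_all _ fun t => ?_)
        simp only
        rw [integral_const_mul, integral_indicator_const _ hB]
        simp [g]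
      · refine Integrable.of_bound (by fun_prop) 1 (ae_of_all _ fun q => ?_)
        rw [norm_mul]
        refine mul_le_one₀ (hu1 _) (norm_nonneg _) ?_
        refine (norm_indicator_le_norm_self _ _).trans (by simp)
    have hgS : Measurable fun t => g (S t) := hg.comp hS
    have hcross : ∫ t, g (S t) * g t ∂p = ∫ t, g t * g t ∂p := by
      rw [← hpair hgS fun t => hg1 _, ← hpair hg hg1]
      conv_rhs => rw [← hinv]
      rw [integral_map (hS.prodMap measurable_id).aemeasurable (by fun_prop)]
      rfl
    have hsq : ∫ t, g (S t) * g (S t) ∂p = ∫ t, g t * g t ∂p := by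
      conv_rhs => rw [← hp]
      rw [integral_map hS.aemeasurable (by fun_prop)]
    have hz : ∫ t, (g (S t) - g t) ^ 2 ∂p = 0 := by
      have i1 := hint hgS hgS (fun t => hg1 _) (fun t => hg1 _)
      have i2 := hint hgS hg (fun t => hg1 _) hg1
      have i3 := hint hg hg hg1 hg1
      have : ∀ t, (g (S t) - g t) ^ 2 =
          (g (S t) * g (S t) - 2 * (g (S t) * g t)) + g t * g t := fun t => by ring
      simp_rw [this]
      have i4 : Integrable (fun t => g (S t) * g (S t) - 2 * (g (S t) * g t)) p :=
        i1.sub (i2.const_mul 2)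
      rw [integral_add i4 i3, integral_sub i1 (i2.const_mul 2),
        integral_const_mul, hsq, hcross]
      ring
    rw [integral_eq_zero_iff_of_nonneg (fun t => sq_nonneg _)] at hz
    · filter_upwards [hz] with t ht
      have h0 : g (S t) = g t := by
        simpa [sub_eq_zero] using ht
      exact (measureReal_eq_measureReal_iff).1 h0
    · refine Integrable.of_bound ((hgS.sub hg).pow_const 2).aestronglyMeasurable 4 (ae_of_all _ fun t => ?_)
      have h1 := abs_le.1 (hg1 (S t))
      have h2 := abs_le.1 (hg1 t)
      rw [Real.norm_of_nonneg (sq_nonneg _)]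
      nlinarith
  refine Kernel.ae_eq_of_compProd_eq (μ := p) (κ := k.comap S hS) (η := k) ?_
  refine Measure.ext_prod fun {s B} hs hB => ?_
  rw [Measure.compProd_apply_prod hs hB, Measure.compProd_apply_prod hs hB]
  refine lintegral_congr_ae (ae_restrict_of_ae ?_)
  filter_upwards [key B hB] with t ht
  rwa [Kernel.comap_apply]

theorem measurable_pi_const_kernel {T X : Type*} [MeasurableSpace T] [MeasurableSpace X]
    (κ : Kernel T X) [IsMarkovKernel κ] (n : ℕ) :
    Measurable fun t => Measure.pi fun _ : Fin n => κ t := by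
  refine Measurable.measure_of_isPiSystem_of_isProbabilityMeasure generateFrom_pi.symm
    isPiSystem_pi ?_
  rintro _ ⟨s, hs, rfl⟩
  simp_rw [Measure.pi_pi]
  exact Finset.measurable_prod _ fun i _ => κ.measurable_coe (hs i (Set.mem_univ i))

/-- The kernel sampling `n` independent points from `κ`. -/
noncomputable def ProbabilityTheory.Kernel.iidFin {T X : Type*} [MeasurableSpace T]
    [MeasurableSpace X] (κ : Kernel T X) [IsMarkovKernel κ] (n : ℕ) : Kernel T (Fin n → X) :=
  ⟨fun t => Measure.pi fun _ : Fin n => κ t, measurable_pi_const_kernel κ n⟩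

theorem ProbabilityTheory.Kernel.iidFin_apply {T X : Type*} [MeasurableSpace T]
    [MeasurableSpace X] (κ : Kernel T X) [IsMarkovKernel κ] (n : ℕ) (t : T) :
    κ.iidFin n t = Measure.pi fun _ : Fin n => κ t := rfl

instance {T X : Type*} [MeasurableSpace T] [MeasurableSpace X] (κ : Kernel T X)
    [IsMarkovKernel κ] (n : ℕ) : IsMarkovKernel (κ.iidFin n) :=
  ⟨fun t => by rw [Kernel.iidFin_apply]; infer_instance⟩

theorem ProbabilityTheory.Kernel.lintegral_iidFin_succ {T X : Type*} [MeasurableSpace T]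
    [MeasurableSpace X] (κ : Kernel T X) [IsMarkovKernel κ] (n : ℕ) (t : T)
    {G : (Fin (n + 1) → X) → ENNReal} (hG : Measurable G) :
    ∫⁻ v, G v ∂(κ.iidFin (n + 1) t) =
      ∫⁻ v, ∫⁻ a, G (Fin.cons a v) ∂(κ t) ∂(κ.iidFin n t) := by
  have hmp := (measurePreserving_piFinSuccAbove (fun _ : Fin (n + 1) => κ t) 0).symm
  simp only [iidFin_apply]
  rw [← hmp.lintegral_comp hG, MeasureTheory.lintegral_prod_symm]
  · simp [MeasurableEquiv.piFinSuccAbove]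
    rfl
  · exact (hG.comp (MeasurableEquiv.measurable _)).aemeasurable

/-- If `(x, y)` has law `p ⊗ₘ h` invariant under reindexing, then conditionally on the shifted
sequence, `x 0` has law `κ` and is independent of `y`. -/
theorem lintegral_compProd_head_tail {X Y : Type*} [MeasurableSpace X] [MeasurableSpace Y]
    (p : Measure (ℕ → X)) [IsProbabilityMeasure p]
    (κ : Kernel (ℕ → X) X) [IsMarkovKernel κ] (h : Kernel (ℕ → X) Y) [IsMarkovKernel h]
    (hκ : p.map (fun x => (fun k => x (k + 1), x 0)) = p ⊗ₘ κ)
    (hh : ∀ᵐ x ∂p, h (fun k => x (k + 1)) = h x)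
    {F : X × (ℕ → X) × Y → ENNReal} (hF : Measurable F) :
    ∫⁻ xy, F (xy.1 0, fun k => xy.1 (k + 1), xy.2) ∂(p ⊗ₘ h) =
      ∫⁻ xy, ∫⁻ a, F (a, xy.1, xy.2) ∂(κ xy.1) ∂(p ⊗ₘ h) := by
  have hsplit : Measurable fun x : ℕ → X => ((fun k => x (k + 1)), x 0) := by fun_prop
  have hG : Measurable fun q : (ℕ → X) × X => ∫⁻ y, F (q.2, q.1, y) ∂(h q.1) :=
    Measurable.lintegral_kernel_prod_right (κ := h.comap Prod.fst measurable_fst)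
      (f := fun (q : (ℕ → X) × X) y => F (q.2, q.1, y)) (by fun_prop)
  have hH : Measurable fun q : (ℕ → X) × Y => ∫⁻ a, F (a, q.1, q.2) ∂(κ q.1) :=
    Measurable.lintegral_kernel_prod_right (κ := κ.comap Prod.fst measurable_fst)
      (f := fun (q : (ℕ → X) × Y) a => F (a, q.1, q.2)) (by fun_prop)
  calc ∫⁻ xy, F (xy.1 0, fun k => xy.1 (k + 1), xy.2) ∂(p ⊗ₘ h)
      = ∫⁻ x, ∫⁻ y, F (x 0, fun k => x (k + 1), y) ∂(h x) ∂p :=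
        Measure.lintegral_compProd (by fun_prop)
    _ = ∫⁻ x, ∫⁻ y, F (x 0, fun k => x (k + 1), y) ∂(h fun k => x (k + 1)) ∂p := by
        refine lintegral_congr_ae ?_
        filter_upwards [hh] with x hx
        rw [hx]
    _ = ∫⁻ q, ∫⁻ y, F (q.2, q.1, y) ∂(h q.1) ∂(p ⊗ₘ κ) := by
        rw [← hκ, lintegral_map hG hsplit]
    _ = ∫⁻ t, ∫⁻ a, ∫⁻ y, F (a, t, y) ∂(h t) ∂(κ t) ∂p := Measure.lintegral_compProd hG
    _ = ∫⁻ t, ∫⁻ y, ∫⁻ a, F (a, t, y) ∂(κ t) ∂(h t) ∂p := by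
        refine lintegral_congr fun t => lintegral_lintegral_swap ?_
        exact Measurable.aemeasurable (by fun_prop)
    _ = ∫⁻ xy, ∫⁻ a, F (a, xy.1, xy.2) ∂(κ xy.1) ∂(p ⊗ₘ h) :=
        (Measure.lintegral_compProd hH).symm

/-- Conditionally on the sequence shifted by `n`, the first `n` coordinates are independent with
law `κ`, and independent of `y`. -/
theorem lintegral_compProd_initial_segment {X Y : Type*} [MeasurableSpace X] [MeasurableSpace Y]
    (p : Measure (ℕ → X)) [IsProbabilityMeasure p]
    (κ : Kernel (ℕ → X) X) [IsMarkovKernel κ] (h : Kernel (ℕ → X) Y) [IsMarkovKernel h]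
    (hκ : p.map (fun x => (fun k => x (k + 1), x 0)) = p ⊗ₘ κ)
    (hh : ∀ᵐ x ∂p, h (fun k => x (k + 1)) = h x)
    (hκn : ∀ n : ℕ, ∀ᵐ x ∂p, κ (fun k => x (n + k)) = κ x) (n : ℕ)
    {G : (Fin n → X) × (ℕ → X) × Y → ENNReal} (hG : Measurable G) :
    ∫⁻ xy, G (fun i => xy.1 i, fun k => xy.1 (n + k), xy.2) ∂(p ⊗ₘ h) =
      ∫⁻ xy, ∫⁻ v, G (v, xy.1, xy.2) ∂(κ.iidFin n xy.1) ∂(p ⊗ₘ h) := by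
  induction n with
  | zero =>
    refine lintegral_congr fun xy => ?_
    rw [Kernel.iidFin_apply, Measure.pi_of_empty, lintegral_dirac]
    simp only [zero_add]
    congr 2
    exact Subsingleton.elim _ _
  | succ n ih =>
    have hcons : Measurable fun q : X × (Fin n → X) => (Fin.cons q.1 q.2 : Fin (n + 1) → X) := by
      refine measurable_pi_lambda _ fun i => ?_
      refine Fin.cases ?_ (fun j => ?_) i
      · simpa using measurable_fst
      · simp only [Fin.cons_succ]
        fun_prop
    have hF : Measurable fun q : X × (ℕ → X) × Y =>
        G (Fin.cons q.1 (fun i : Fin n => q.2.1 i), fun k => q.2.1 (n + k), q.2.2) := by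
      refine hG.comp (Measurable.prodMk (hcons.comp (f := fun q : X × (ℕ → X) × Y =>
        (q.1, fun i : Fin n => q.2.1 i)) ?_) ?_) <;> fun_prop
    have hH : Measurable fun q : (Fin n → X) × (ℕ → X) × Y =>
        ∫⁻ a, G (Fin.cons a q.1, q.2.1, q.2.2) ∂(κ q.2.1) := by
      refine Measurable.lintegral_kernel_prod_right
        (κ := κ.comap (fun q : (Fin n → X) × (ℕ → X) × Y => q.2.1) (by fun_prop))
        (f := fun q a => G (Fin.cons a q.1, q.2.1, q.2.2)) ?_
      refine hG.comp (Measurable.prodMk (hcons.comp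
        (f := fun r : ((Fin n → X) × (ℕ → X) × Y) × X => (r.2, r.1.1)) ?_) ?_) <;> fun_prop
    have hae : ∀ᵐ xy ∂(p ⊗ₘ h), κ (fun k => xy.1 (n + k)) = κ xy.1 := by
      have : ∀ᵐ x ∂(p ⊗ₘ h).map Prod.fst, κ (fun k => x (n + k)) = κ x := by
        rw [← Measure.fst, Measure.fst_compProd]
        exact hκn n
      exact ae_of_ae_map measurable_fst.aemeasurable this
    calc ∫⁻ xy, G (fun i => xy.1 i, fun k => xy.1 (n + 1 + k), xy.2) ∂(p ⊗ₘ h)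
        = ∫⁻ xy, G (Fin.cons (xy.1 0) (fun i : Fin n => xy.1 (i + 1)),
            fun k => xy.1 (n + k + 1), xy.2) ∂(p ⊗ₘ h) := by
          refine lintegral_congr fun xy => ?_
          congr 2
          · ext i
            refine Fin.cases ?_ (fun j => ?_) i <;> simp
          · simp only [add_right_comm]
      _ = ∫⁻ xy, ∫⁻ a, G (Fin.cons a (fun i : Fin n => xy.1 i), fun k => xy.1 (n + k), xy.2)
            ∂(κ xy.1) ∂(p ⊗ₘ h) := lintegral_compProd_head_tail p κ h hκ hh hF
      _ = ∫⁻ xy, ∫⁻ a, G (Fin.cons a (fun i : Fin n => xy.1 i), fun k => xy.1 (n + k), xy.2)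
            ∂(κ fun k => xy.1 (n + k)) ∂(p ⊗ₘ h) := by
          refine lintegral_congr_ae ?_
          filter_upwards [hae] with xy hxy
          rw [hxy]
      _ = ∫⁻ xy, ∫⁻ v, ∫⁻ a, G (Fin.cons a v, xy.1, xy.2) ∂(κ xy.1) ∂(κ.iidFin n xy.1)
            ∂(p ⊗ₘ h) := ih hH
      _ = ∫⁻ xy, ∫⁻ v, G (v, xy.1, xy.2) ∂(κ.iidFin (n + 1) xy.1) ∂(p ⊗ₘ h) := by
          refine lintegral_congr fun xy => ?_
          rw [Kernel.lintegral_iidFin_succ κ n xy.1 (G := fun v => G (v, xy.1, xy.2))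
            (by fun_prop)]

/-- **De Finetti Theorem for dilations (strong form)**: let `π` be a probability measure on
`(ℕ → X) × Y` (`X`, `Y` standard Borel) invariant under `(x, y) ↦ (x ∘ σ, y)` for all
finite permutations `σ` of `ℕ`, let `p` be its marginal on `ℕ → X`, let `κ` be a regular
conditional distribution of `x 0` given the shifted sequence `fun k => x (k + 1)` under
`p`, and let `h` be a regular conditional distribution of `y` given `x` under `π`.  Then
for every `n`, the joint law under `π` of `((x 0, …, x (n-1)), fun k => x (n + k), y)` is
obtained by sampling `t` from `p`, then independently sampling the `n` components i.i.d.
from `κ t` and `y` from `h t`, and outputting `(samples, t, y)`. -/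
theorem deFinetti_dilation_strong
    {X Y : Type*} [MeasurableSpace X] [MeasurableSpace Y]
    [StandardBorelSpace X] [StandardBorelSpace Y]
    (π : Measure ((ℕ → X) × Y)) [IsProbabilityMeasure π]
    (hπ : ∀ σ : Equiv.Perm ℕ, {n | σ n ≠ n}.Finite →
      π.map (fun xy => (xy.1 ∘ σ, xy.2)) = π)
    (κ : Kernel (ℕ → X) X) [IsMarkovKernel κ]
    (hκ : (π.map Prod.fst).map (fun x => (fun k => x (k + 1), x 0)) =
      ((π.map Prod.fst).map (fun x => fun k => x (k + 1))) ⊗ₘ κ)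
    (h : Kernel (ℕ → X) Y) [IsMarkovKernel h]
    (hh : π = (π.map Prod.fst) ⊗ₘ h) :
    ∀ n : ℕ,
      π.map (fun xy => ((fun i : Fin n => xy.1 i), (fun k => xy.1 (n + k)), xy.2)) =
        (π.map Prod.fst).bind (fun t =>
          ((Measure.pi fun _ : Fin n => κ t).prod (h t)).map
            (fun vy => (vy.1, t, vy.2))) := by
  intro n
  have hmap {f : ℕ → ℕ} (hf : Function.Injective f) :=
    map_comp_injective_eq_of_exchangeable π hπ hf
  obtain ⟨p, hp⟩ : ∃ p, p = π.map Prod.fst := ⟨_, rfl⟩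
  rw [← hp] at hκ hh ⊢
  have : IsProbabilityMeasure p := hp ▸ Measure.isProbabilityMeasure_map (by fun_prop)
  have hpmap {f : ℕ → ℕ} (hf : Function.Injective f) : p.map (fun x => x ∘ f) = p := by
    have hm : Measurable fun x : ℕ → X => x ∘ f :=
      measurable_pi_lambda _ fun k => measurable_pi_apply (f k)
    conv_rhs => rw [hp, ← hmap hf]
    rw [hp, Measure.map_map hm measurable_fst, Measure.map_map measurable_fst]
    · rfl
    · exact (hm.comp measurable_fst).prodMk measurable_snd
  have hshift (n : ℕ) : Measurable fun x : ℕ → X => fun k => x (n + k) := by fun_prop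
  have hκ' : p.map (fun x => (fun k => x (k + 1), x 0)) = p ⊗ₘ κ := by
    rw [hκ]
    congr 1
    exact hpmap (f := (· + 1)) (add_left_injective 1)
  have hκn (n : ℕ) : ∀ᵐ x ∂p, κ (fun k => x (n + k)) = κ x := by
    refine ae_apply_eq_of_map_compProd_eq p κ (hshift n) ?_
    have hf : Function.Injective fun k : ℕ => if k = 0 then 0 else n + k := by
      intro a b hab
      grind
    rw [← hκ', Measure.map_map ((hshift n).prodMap measurable_id) (by fun_prop)]
    conv_rhs => rw [← hpmap hf]
    have hm : Measurable fun x : ℕ → X => x ∘ fun k => if k = 0 then 0 else n + k :=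
      measurable_pi_lambda _ fun k => measurable_pi_apply _
    have hsplit : Measurable fun x : ℕ → X => ((fun k => x (k + 1)), x 0) := by fun_prop
    rw [Measure.map_map hsplit hm]
    congr 1
  have hhs : ∀ᵐ x ∂p, h (fun k => x (k + 1)) = h x := by
    refine ae_apply_eq_of_map_compProd_eq p h (by fun_prop) ?_
    rw [← hh]
    exact hmap (f := (· + 1)) (add_left_injective 1)
  have hsample (t : ℕ → X) : ((Measure.pi fun _ : Fin n => κ t).prod (h t)).map
      (fun vy => (vy.1, t, vy.2)) =
      (((κ.iidFin n) ×ₖ h) ×ₖ Kernel.id).map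
        (fun q : ((Fin n → X) × Y) × (ℕ → X) => (q.1.1, q.2, q.1.2)) t := by
    rw [Kernel.map_apply _ (by fun_prop), Kernel.prod_apply, Kernel.prod_apply, Kernel.id_apply,
      Measure.prod_dirac, Measure.map_map (by fun_prop) (by fun_prop)]
    rfl
  refine Measure.ext fun s hs => ?_
  rw [Measure.bind_apply hs (by simp_rw [hsample]; exact Kernel.aemeasurable _),
    ← lintegral_indicator_one hs, lintegral_map (measurable_one.indicator hs) (by fun_prop), hh]
  have hG : Measurable (s.indicator (1 : (Fin n → X) × (ℕ → X) × Y → ENNReal)) :=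
    measurable_one.indicator hs
  rw [lintegral_compProd_initial_segment p κ h hκ' hhs hκn n hG, Measure.lintegral_compProd]
  · refine lintegral_congr fun t => ?_
    have ht : Measurable fun vy : (Fin n → X) × Y => (vy.1, t, vy.2) := by fun_prop
    rw [← lintegral_indicator_one hs, lintegral_map hG ht, lintegral_prod_symm']
    · rfl
    · exact hG.comp ht
  · exact Measurable.lintegral_kernel_prod_right
      (κ := (κ.iidFin n).comap Prod.fst measurable_fst)
      (f := fun (q : (ℕ → X) × Y) v => s.indicator 1 (v, q.1, q.2)) (by fun_prop)
end
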